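/- arXiv:2304.00366 — 3 statements merged into one kernel-verified Lean document; each statement's English description precedes it below -/
import Mathlib

section
/- (Sharpness of Fenchel's inequality; b₂(Oₙ) = 2.) Let n ≥ 2, let K = Oₙ = {x ∈ ℝⁿ : Σᵢ|xᵢ| ≤ 1} be the cross-polytope, and let L₁ = [0, e₁+e₂] and L₂ = [0, e₁−e₂] be the segments from the origin to e₁+e₂ and to e₁−e₂ respectively, where e₁, e₂ are the first two standard basis vectors. Then V(L₁,K[n−1])·V(L₂,K[n−1]) = (1/2)·V(L₁,L₂,K[n−2])·vol(K). -/
open Pointwise MeasureTheory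

/-- The mixed volume of `n` compact convex sets in `ℝⁿ`, defined by the polarization
formula `V(A₁,…,Aₙ) = (1/n!) Σ_{∅≠J⊆[n]} (−1)^{n−|J|} vol(Σ_{j∈J} Aⱼ)`. -/
noncomputable def mixedVol (n : ℕ) (A : Fin n → Set (EuclideanSpace ℝ (Fin n))) : ℝ :=
  (1 / (Nat.factorial n : ℝ)) *
    ∑ J ∈ Finset.univ.powerset.filter (fun J : Finset (Fin n) => J ≠ ∅),
      (-1 : ℝ) ^ (n - J.card) * (volume (∑ j ∈ J, A j)).toReal

theorem measurePreserving_cons (N : ℕ) :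
    MeasurePreserving (fun p : ℝ × (Fin N → ℝ) => (Fin.cons p.1 p.2 : Fin (N + 1) → ℝ)) := by
  have h := (volume_preserving_piFinSuccAbove (fun _ : Fin (N + 1) => ℝ) 0).symm
  convert! h using 1
  ext p : 1
  exact (Fin.insertNth_zero (α := fun _ => ℝ) p.1 p.2).symm

theorem volume_eq_lintegral_cons {N : ℕ} {s : Set (Fin (N + 1) → ℝ)} (hs : MeasurableSet s) :
    volume s = ∫⁻ w : Fin N → ℝ, volume {t : ℝ | (Fin.cons t w : Fin (N + 1) → ℝ) ∈ s} := by
  have h := measurePreserving_cons N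
  rw [← h.measure_preimage hs.nullMeasurableSet, Measure.volume_eq_prod,
    Measure.prod_apply_symm (h.measurable hs)]
  rfl

theorem volume_eq_lintegral_cons_cons {N : ℕ} {s : Set (Fin (N + 2) → ℝ)}
    (hs : MeasurableSet s) :
    volume s = ∫⁻ w : Fin N → ℝ,
      volume {p : ℝ × ℝ | (Fin.cons p.1 (Fin.cons p.2 w) : Fin (N + 2) → ℝ) ∈ s} := by
  have h := (measurePreserving_cons (N + 1)).comp
    (((MeasurePreserving.id (volume : Measure ℝ)).prod (measurePreserving_cons N)).comp
      (volume_preserving_prodAssoc (α₁ := ℝ) (β₁ := ℝ) (γ₁ := Fin N → ℝ)))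
  rw [← h.measure_preimage hs.nullMeasurableSet, Measure.volume_eq_prod,
    Measure.prod_apply_symm (h.measurable hs)]
  rfl

theorem volume_l1Ball (N : ℕ) {r : ℝ} (hr : 0 ≤ r) :
    volume {x : Fin N → ℝ | ∑ i, |x i| ≤ r} = ENNReal.ofReal ((2 * r) ^ N / N.factorial) := by
  rcases Nat.eq_zero_or_pos N with rfl | hN
  · simp [hr, Measure.volume_pi_eq_dirac 0]
  · have : Nonempty (Fin N) := ⟨⟨0, hN⟩⟩
    have h := MeasureTheory.volume_sum_rpow_le (Fin N) (p := 1) le_rfl r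
    simp only [Real.rpow_one, div_one, Fintype.card_fin] at h
    rw [h, Real.Gamma_nat_eq_factorial, ← ENNReal.ofReal_pow hr,
      ← ENNReal.ofReal_mul (by positivity)]
    have : Real.Gamma (1 + 1) = 1 := by simpa using Real.Gamma_nat_eq_factorial 1
    rw [this]
    congr 1
    rw [mul_pow]
    ring

theorem volume_rotated_box (a b c d : ℝ) :
    volume {p : ℝ × ℝ | p.1 + p.2 ∈ Set.Icc a b ∧ p.1 - p.2 ∈ Set.Icc c d} =
      ENNReal.ofReal 2⁻¹ * (ENNReal.ofReal (b - a) * ENNReal.ofReal (d - c)) := by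
  let f : ℝ × ℝ →ₗ[ℝ] ℝ × ℝ :=
    (LinearMap.fst ℝ ℝ ℝ + LinearMap.snd ℝ ℝ ℝ).prod (LinearMap.fst ℝ ℝ ℝ - LinearMap.snd ℝ ℝ ℝ)
  have hf : LinearMap.det f = -2 := by
    rw [← LinearMap.det_toMatrix (Module.Basis.finTwoProd ℝ), Matrix.det_fin_two]
    simp [LinearMap.toMatrix_apply, f]
    norm_num
  have h := Measure.addHaar_preimage_linearMap (volume : Measure (ℝ × ℝ)) (f := f)
    (by rw [hf]; norm_num) (Set.Icc a b ×ˢ Set.Icc c d)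
  rw [hf, Measure.volume_eq_prod, Measure.prod_prod, Real.volume_Icc, Real.volume_Icc] at h
  rw [show |(-2 : ℝ)⁻¹| = 2⁻¹ by rw [abs_inv]; norm_num] at h
  exact h

/-- The Minkowski sum of the `ℓ¹` ball of radius `m` with the segments `[0, a • (e₀ + e₁)]` and
`[0, b • (e₀ - e₁)]`, described by inequalities. -/
def stretchedBall (N : ℕ) (a b m : ℝ) : Set (Fin (N + 2) → ℝ) :=
  {x | ∑ i : Fin N, |x i.succ.succ| ≤ m ∧
    x 0 + x 1 ∈ Set.Icc (-(m - ∑ i : Fin N, |x i.succ.succ|))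
      (m - ∑ i : Fin N, |x i.succ.succ| + 2 * a) ∧
    x 0 - x 1 ∈ Set.Icc (-(m - ∑ i : Fin N, |x i.succ.succ|))
      (m - ∑ i : Fin N, |x i.succ.succ| + 2 * b)}

theorem measurableSet_stretchedBall (N : ℕ) (a b m : ℝ) :
    MeasurableSet (stretchedBall N a b m) := by
  unfold stretchedBall
  simp only [Set.mem_Icc]
  measurability

theorem abs_add_abs_le_iff {x y r : ℝ} : |x| + |y| ≤ r ↔ |x + y| ≤ r ∧ |x - y| ≤ r := by
  constructor
  · exact fun h => ⟨(abs_add_le x y).trans h, (abs_sub x y).trans h⟩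
  · rintro ⟨h₁, h₂⟩
    rw [abs_le] at h₁ h₂
    rcases abs_cases x with hx | hx <;> rcases abs_cases y with hy | hy <;> linarith

theorem stretchedBall_zero (N : ℕ) (m : ℝ) :
    stretchedBall N 0 0 m = {x | ∑ i, |x i| ≤ m} := by
  ext x
  have h := abs_add_abs_le_iff (x := x 0) (y := x 1)
    (r := m - ∑ i : Fin N, |x i.succ.succ|)
  simp only [stretchedBall, Set.mem_ofPred_eq, Set.mem_Icc, mul_zero, add_zero, ← abs_le, ← h,
    Fin.sum_univ_succ, Fin.succ_zero_eq_one]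
  constructor
  · rintro ⟨-, h⟩
    linarith
  · intro h
    have := abs_nonneg (x 0)
    have := abs_nonneg (x 1)
    constructor <;> linarith

theorem volume_stretchedBall (N : ℕ) {a b m : ℝ} (ha : 0 ≤ a) (hb : 0 ≤ b) (hm : 0 ≤ m) :
    (volume (stretchedBall N a b m)).toReal = (2 * m) ^ (N + 2) / (N + 2).factorial +
      (a + b) * ((2 * m) ^ (N + 1) / (N + 1).factorial) +
      2 * a * b * ((2 * m) ^ N / N.factorial) := by
  have hmeas (k : ℕ) : MeasurableSet {x : Fin k → ℝ | ∑ i, |x i| ≤ m} := by measurability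
  have key : volume (stretchedBall N a b m) =
      volume (stretchedBall N 0 0 m) +
      ENNReal.ofReal (a + b) * volume {x : Fin (N + 1) → ℝ | ∑ i, |x i| ≤ m} +
      ENNReal.ofReal (2 * a * b) * volume {x : Fin N → ℝ | ∑ i, |x i| ≤ m} := by
    have hslice (a b : ℝ) (w : Fin N → ℝ) (hw : ∑ i, |w i| ≤ m) :
        volume {p : ℝ × ℝ | (Fin.cons p.1 (Fin.cons p.2 w) : Fin (N + 2) → ℝ) ∈
          stretchedBall N a b m} = ENNReal.ofReal 2⁻¹ *
            (ENNReal.ofReal (2 * (m - ∑ i, |w i|) + 2 * a) *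
              ENNReal.ofReal (2 * (m - ∑ i, |w i|) + 2 * b)) := by
      simp only [stretchedBall, Set.mem_ofPred_eq, Fin.cons_succ, Fin.cons_zero, Fin.cons_one, hw,
        true_and]
      rw [volume_rotated_box]
      congr 3 <;> ring
    have hslice' (a b : ℝ) (w : Fin N → ℝ) (hw : ¬ ∑ i, |w i| ≤ m) :
        volume {p : ℝ × ℝ | (Fin.cons p.1 (Fin.cons p.2 w) : Fin (N + 2) → ℝ) ∈
          stretchedBall N a b m} = 0 := by
      simp [stretchedBall, hw]
    have hline (w : Fin N → ℝ) :
        volume {t : ℝ | (Fin.cons t w : Fin (N + 1) → ℝ) ∈ {x | ∑ i, |x i| ≤ m}} =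
          ENNReal.ofReal (2 * (m - ∑ i, |w i|)) := by
      have : {t : ℝ | (Fin.cons t w : Fin (N + 1) → ℝ) ∈ {x | ∑ i, |x i| ≤ m}} =
          Set.Icc (-(m - ∑ i, |w i|)) (m - ∑ i, |w i|) := by
        ext t
        simp only [Set.mem_ofPred_eq, Fin.sum_univ_succ, Fin.cons_zero, Fin.cons_succ,
          Set.mem_Icc, ← abs_le]
        exact le_sub_iff_add_le.symm
      rw [this, Real.volume_Icc]
      congr 1
      ring
    have hmeasurable : Measurable fun w : Fin N → ℝ =>
        ENNReal.ofReal (2 * (m - ∑ i, |w i|)) := by fun_prop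
    rw [volume_eq_lintegral_cons_cons (measurableSet_stretchedBall N a b m),
      volume_eq_lintegral_cons_cons (measurableSet_stretchedBall N 0 0 m),
      volume_eq_lintegral_cons (hmeas (N + 1)), ← lintegral_indicator_one (hmeas N)]
    simp only [hline]
    rw [← lintegral_const_mul _ hmeasurable,
      ← lintegral_const_mul _ (measurable_one.indicator (hmeas N)),
      ← lintegral_add_right _ (by fun_prop),
      ← lintegral_add_right _ ((measurable_one.indicator (hmeas N)).const_mul _)]
    congr 1 with w
    by_cases hw : ∑ i, |w i| ≤ m
    · have hr : 0 ≤ m - ∑ i, |w i| := sub_nonneg.2 hw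
      rw [hslice a b w hw, hslice 0 0 w hw, Set.indicator_of_mem (by exact hw)]
      generalize m - ∑ i, |w i| = r at hr
      rw [Pi.one_apply, mul_one, ← ENNReal.ofReal_mul (by positivity),
        ← ENNReal.ofReal_mul (by positivity), ← ENNReal.ofReal_mul (by positivity),
        ← ENNReal.ofReal_mul (by positivity), ← ENNReal.ofReal_mul (by positivity),
        ← ENNReal.ofReal_add (by positivity) (by positivity),
        ← ENNReal.ofReal_add (by positivity) (by positivity)]
      congr 1
      ring
    · rw [hslice' a b w hw, hslice' 0 0 w hw, Set.indicator_of_notMem (by exact hw),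
        ENNReal.ofReal_of_nonpos (show 2 * (m - ∑ i, |w i|) ≤ 0 by linarith)]
      simp
  rw [key, stretchedBall_zero, volume_l1Ball _ hm, volume_l1Ball _ hm, volume_l1Ball _ hm,
    ← ENNReal.ofReal_mul (by positivity), ← ENNReal.ofReal_mul (by positivity),
    ← ENNReal.ofReal_add (by positivity) (by positivity),
    ← ENNReal.ofReal_add (by positivity) (by positivity), ENNReal.toReal_ofReal (by positivity)]

/-- The closed `ℓ¹` ball of radius `m` in Euclidean space. -/
def euclideanL1Ball (n : ℕ) (m : ℝ) : Set (EuclideanSpace ℝ (Fin n)) :=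
  {x | ∑ i, |x i| ≤ m}

theorem euclideanL1Ball_zero (n : ℕ) : euclideanL1Ball n 0 = 0 := by
  ext x
  have h : ∑ i, |x i| ≤ 0 ↔ ∑ i, |x i| = 0 :=
    ⟨fun h => le_antisymm h (Finset.sum_nonneg fun i _ => abs_nonneg _), le_of_eq⟩
  rw [euclideanL1Ball, Set.mem_ofPred_eq, h,
    Finset.sum_eq_zero_iff_of_nonneg fun i _ => abs_nonneg _, Set.mem_zero]
  constructor
  · intro h
    ext i
    simpa using h i
  · rintro rfl
    simp

theorem euclideanL1Ball_add (n : ℕ) {m k : ℝ} (hm : 0 ≤ m) (hk : 0 < k) :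
    euclideanL1Ball n m + euclideanL1Ball n k = euclideanL1Ball n (m + k) := by
  ext x
  simp only [Set.mem_add, euclideanL1Ball, Set.mem_ofPred_eq]
  constructor
  · rintro ⟨y, hy, z, hz, rfl⟩
    refine le_trans ?_ (add_le_add hy hz)
    rw [← Finset.sum_add_distrib]
    exact Finset.sum_le_sum fun i _ => abs_add_le _ _
  · intro hx
    have hmk : 0 < m + k := by linarith
    have hscale (c : ℝ) (hc : 0 ≤ c) : ∑ i, |((c / (m + k)) • x) i| ≤ c := by
      simp only [PiLp.smul_apply, smul_eq_mul, abs_mul, ← Finset.mul_sum]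
      rw [abs_of_nonneg (by positivity), div_mul_eq_mul_div, div_le_iff₀ hmk]
      exact mul_le_mul_of_nonneg_left hx hc
    refine ⟨(m / (m + k)) • x, hscale m hm, (k / (m + k)) • x, hscale k hk.le, ?_⟩
    rw [← add_smul, ← add_div, div_self hmk.ne', one_smul]

theorem sum_euclideanL1Ball {ι : Type*} (n : ℕ) (J : Finset ι) :
    ∑ _j ∈ J, euclideanL1Ball n 1 = euclideanL1Ball n J.card := by
  classical
  induction J using Finset.induction_on with
  | empty => simp [euclideanL1Ball_zero]
  | insert a s ha ih =>
    rw [Finset.sum_insert ha, ih, add_comm, euclideanL1Ball_add n (by positivity) one_pos,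
      Finset.card_insert_of_notMem ha]
    push_cast
    rfl

theorem segment_add_segment_add_euclideanL1Ball (N : ℕ) {a b : ℝ} (m : ℝ) (ha : 0 ≤ a)
    (hb : 0 ≤ b) :
    segment ℝ 0 (a • (EuclideanSpace.single (0 : Fin (N + 2)) (1 : ℝ) +
        EuclideanSpace.single (1 : Fin (N + 2)) (1 : ℝ))) +
      (segment ℝ 0 (b • (EuclideanSpace.single (0 : Fin (N + 2)) (1 : ℝ) -
        EuclideanSpace.single (1 : Fin (N + 2)) (1 : ℝ))) +
      euclideanL1Ball (N + 2) m) = WithLp.ofLp ⁻¹' stretchedBall N a b m := by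
  have hsum (y : EuclideanSpace ℝ (Fin (N + 2))) :
      ∑ i, |y i| = |y 0| + |y 1| + ∑ i : Fin N, |y i.succ.succ| := by
    simp only [Fin.sum_univ_succ, Fin.succ_zero_eq_one]
    ring
  have hclamp {r a s : ℝ} (ha : 0 ≤ a) (hr : 0 ≤ r) (h₁ : -r ≤ s) (h₂ : s ≤ r + 2 * a) :
      ∃ t ∈ Set.Icc (0 : ℝ) 1, |s - 2 * (t * a)| ≤ r := by
    rcases le_total s r with hs | hs
    · exact ⟨0, by simp, by simpa [abs_le] using ⟨h₁, hs⟩⟩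
    · rcases ha.eq_or_lt with rfl | ha
      · exact ⟨0, by simp, by rw [abs_le]; constructor <;> linarith⟩
      · refine ⟨(s - r) / (2 * a), ⟨div_nonneg (by linarith) (by linarith),
          (div_le_one (by linarith)).2 (by linarith)⟩, ?_⟩
        rw [show s - 2 * ((s - r) / (2 * a) * a) = r by field_simp; ring, abs_of_nonneg hr]
  have hne (i : Fin N) : i.succ.succ ≠ (1 : Fin (N + 2)) :=
    fun h => Fin.succ_ne_zero i (Fin.succ_injective _ h)
  ext x
  simp only [segment_eq_image, smul_zero, zero_add, Set.mem_add, Set.mem_image,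
    Set.mem_preimage, stretchedBall, Set.mem_ofPred_eq, euclideanL1Ball, hsum]
  constructor
  · rintro ⟨_, ⟨t, ht, rfl⟩, _, ⟨_, ⟨u, hu, rfl⟩, y, hy, rfl⟩, rfl⟩
    have ht' := mul_le_mul_of_nonneg_right ht.2 ha
    have hu' := mul_le_mul_of_nonneg_right hu.2 hb
    have ht'' := mul_nonneg ht.1 ha
    have hu'' := mul_nonneg hu.1 hb
    have h := abs_add_abs_le_iff.1 (le_sub_iff_add_le.2 hy)
    simp only [abs_le] at h
    have := abs_nonneg (y 0)
    have := abs_nonneg (y 1)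
    simp [hne, Set.mem_Icc]
    refine ⟨by linarith, ⟨?_, ?_⟩, ?_, ?_⟩ <;> linarith
  · rintro ⟨hw, ⟨h₁, h₂⟩, h₃, h₄⟩
    obtain ⟨t, ht, hta⟩ := hclamp ha (sub_nonneg.2 hw) h₁ h₂
    obtain ⟨u, hu, hub⟩ := hclamp hb (sub_nonneg.2 hw) h₃ h₄
    refine ⟨_, ⟨t, ht, rfl⟩, _, ⟨_, ⟨u, hu, rfl⟩,
      x - t • a • (EuclideanSpace.single 0 1 + EuclideanSpace.single 1 1) -
        u • b • (EuclideanSpace.single 0 1 - EuclideanSpace.single 1 1), ?_, rfl⟩, by abel⟩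
    rw [← le_sub_iff_add_le, abs_add_abs_le_iff]
    simp [hne]
    constructor
    · convert hta using 2
      ring
    · convert hub using 2
      ring

theorem volume_segment_add_segment_add_euclideanL1Ball (N : ℕ) {a b m : ℝ} (ha : 0 ≤ a)
    (hb : 0 ≤ b) (hm : 0 ≤ m) :
    (volume (segment ℝ 0 (a • (EuclideanSpace.single (0 : Fin (N + 2)) (1 : ℝ) +
        EuclideanSpace.single (1 : Fin (N + 2)) (1 : ℝ))) +
      (segment ℝ 0 (b • (EuclideanSpace.single (0 : Fin (N + 2)) (1 : ℝ) -
        EuclideanSpace.single (1 : Fin (N + 2)) (1 : ℝ))) +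
      euclideanL1Ball (N + 2) m))).toReal = (2 * m) ^ (N + 2) / (N + 2).factorial +
      (a + b) * ((2 * m) ^ (N + 1) / (N + 1).factorial) +
      2 * a * b * ((2 * m) ^ N / N.factorial) := by
  rw [segment_add_segment_add_euclideanL1Ball N m ha hb,
    (PiLp.volume_preserving_ofLp _).measure_preimage
      (measurableSet_stretchedBall N a b m).nullMeasurableSet,
    volume_stretchedBall N ha hb hm]

theorem sum_powerset_neg_one_pow_mul_card_pow {ι : Type*} (s : Finset ι) :
    ∑ J ∈ s.powerset, (-1 : ℝ) ^ (s.card - J.card) * (J.card : ℝ) ^ s.card =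
      s.card.factorial := by
  have h := congrFun (fwdDiff_iter_eq_factorial (R := ℝ) (n := s.card)) 0
  rw [fwdDiff_iter_eq_sum_shift] at h
  rw [Finset.sum_powerset_apply_card
    (fun k => (-1 : ℝ) ^ (s.card - k) * (k : ℝ) ^ s.card)]
  simp only [Pi.natCast_apply] at h
  rw [← h]
  refine Finset.sum_congr rfl fun k _ => ?_
  simp only [zsmul_eq_mul, nsmul_eq_mul]
  push_cast
  simp
  ring

theorem mixedVol_eq_sum_powerset (N : ℕ) (A : Fin (N + 1) → Set (EuclideanSpace ℝ (Fin (N + 1)))) :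
    mixedVol (N + 1) A = (1 / ((N + 1).factorial : ℝ)) *
      ∑ J ∈ Finset.univ.powerset, (-1 : ℝ) ^ (N + 1 - J.card) *
        (volume (∑ j ∈ J, A j)).toReal := by
  rw [mixedVol, Finset.sum_filter_of_ne]
  rintro J - hJ rfl
  apply hJ
  rw [Finset.sum_empty, ← Set.singleton_zero, measure_singleton]
  simp

theorem mixedVol_one_segment (N : ℕ) (L : Set (EuclideanSpace ℝ (Fin (N + 1)))) (c : ℝ)
    (hc : ∀ m : ℕ, (volume (L + euclideanL1Ball (N + 1) m)).toReal -
      (volume (euclideanL1Ball (N + 1) m)).toReal = c * (m : ℝ) ^ N) :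
    mixedVol (N + 1) (fun i => if (i : ℕ) = 0 then L else euclideanL1Ball (N + 1) 1) =
      c * N.factorial / (N + 1).factorial := by
  set A : Fin (N + 1) → Set (EuclideanSpace ℝ (Fin (N + 1))) :=
    fun i => if (i : ℕ) = 0 then L else euclideanL1Ball (N + 1) 1
  set s : Finset (Fin (N + 1)) := Finset.univ.erase 0 with hs
  have hcard : s.card = N := by simp [hs]
  have h0 : (0 : Fin (N + 1)) ∉ s := by simp [hs]
  have hball (J : Finset (Fin (N + 1))) (hJ : J ⊆ s) :
      ∑ j ∈ J, A j = euclideanL1Ball (N + 1) J.card := by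
    rw [← sum_euclideanL1Ball]
    refine Finset.sum_congr rfl fun j hj => if_neg ?_
    rw [Fin.val_eq_zero_iff]
    exact Finset.ne_of_mem_erase (hJ hj)
  have key := sum_powerset_neg_one_pow_mul_card_pow s
  rw [hcard] at key
  rw [mixedVol_eq_sum_powerset, ← Finset.insert_erase (Finset.mem_univ (0 : Fin (N + 1))), ← hs,
    Finset.sum_powerset_insert h0, ← Finset.sum_add_distrib, ← key, mul_div_assoc, Finset.sum_div,
    Finset.mul_sum, Finset.mul_sum]
  refine Finset.sum_congr rfl fun J hJ => ?_
  rw [Finset.mem_powerset] at hJ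
  have hJ0 : (0 : Fin (N + 1)) ∉ J := fun h => h0 (hJ h)
  have hle : J.card ≤ N := (Finset.card_le_card hJ).trans_eq hcard
  rw [Finset.sum_insert hJ0, Finset.card_insert_of_notMem hJ0, hball J hJ,
    show A 0 = L from if_pos rfl, Nat.add_sub_add_right, Nat.sub_add_comm hle, pow_succ]
  linear_combination (-1 : ℝ) ^ (N - J.card) / (N + 1).factorial * hc J.card

theorem mixedVol_two_segments (N : ℕ) (L₁ L₂ : Set (EuclideanSpace ℝ (Fin (N + 2)))) (d : ℝ)
    (hd : ∀ m : ℕ, (volume (L₁ + (L₂ + euclideanL1Ball (N + 2) m))).toReal -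
      (volume (L₁ + euclideanL1Ball (N + 2) m)).toReal -
      (volume (L₂ + euclideanL1Ball (N + 2) m)).toReal +
      (volume (euclideanL1Ball (N + 2) m)).toReal = d * (m : ℝ) ^ N) :
    mixedVol (N + 2) (fun i => if (i : ℕ) = 0 then L₁ else if (i : ℕ) = 1 then L₂ else
      euclideanL1Ball (N + 2) 1) = d * N.factorial / (N + 2).factorial := by
  set A : Fin (N + 2) → Set (EuclideanSpace ℝ (Fin (N + 2))) :=
    fun i => if (i : ℕ) = 0 then L₁ else if (i : ℕ) = 1 then L₂ else
      euclideanL1Ball (N + 2) 1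
  set s : Finset (Fin (N + 2)) := (Finset.univ.erase 0).erase 1 with hs
  have hcard : s.card = N := by simp [hs]
  have h1 : (1 : Fin (N + 2)) ∉ s := by simp [hs]
  have h0 : (0 : Fin (N + 2)) ∉ s := by simp [hs]
  have h01 : (0 : Fin (N + 2)) ∉ insert 1 s := by simp [h0]
  have huniv : (Finset.univ : Finset (Fin (N + 2))) = insert 0 (insert 1 s) := by
    rw [hs, Finset.insert_erase (by simp), Finset.insert_erase (by simp)]
  have hball (J : Finset (Fin (N + 2))) (hJ : J ⊆ s) :
      ∑ j ∈ J, A j = euclideanL1Ball (N + 2) J.card := by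
    rw [← sum_euclideanL1Ball]
    refine Finset.sum_congr rfl fun j hj => ?_
    have hj1 : j ≠ 1 := Finset.ne_of_mem_erase (hJ hj)
    have hj0 : j ≠ 0 := Finset.ne_of_mem_erase (Finset.mem_of_mem_erase (hJ hj))
    rw [Ne, Fin.ext_iff] at hj0 hj1
    exact (if_neg hj0).trans (if_neg hj1)
  have key := sum_powerset_neg_one_pow_mul_card_pow s
  rw [hcard] at key
  rw [mixedVol_eq_sum_powerset, huniv, Finset.sum_powerset_insert h01,
    Finset.sum_powerset_insert h1, Finset.sum_powerset_insert h1, ← Finset.sum_add_distrib,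
    ← Finset.sum_add_distrib, ← Finset.sum_add_distrib, ← key, mul_div_assoc, Finset.sum_div,
    Finset.mul_sum, Finset.mul_sum]
  refine Finset.sum_congr rfl fun J hJ => ?_
  rw [Finset.mem_powerset] at hJ
  have hJ0 : (0 : Fin (N + 2)) ∉ J := fun h => h0 (hJ h)
  have hJ1 : (1 : Fin (N + 2)) ∉ J := fun h => h1 (hJ h)
  have hJ01 : (0 : Fin (N + 2)) ∉ insert 1 J := by simp [hJ0]
  have hle : J.card ≤ N := (Finset.card_le_card hJ).trans_eq hcard
  rw [Finset.sum_insert hJ01, Finset.sum_insert hJ0, Finset.sum_insert hJ1,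
    Finset.card_insert_of_notMem hJ01, Finset.card_insert_of_notMem hJ0,
    Finset.card_insert_of_notMem hJ1, hball J hJ, show A 0 = L₁ from if_pos rfl,
    show A 1 = L₂ from rfl,
    show N + 1 + 1 - J.card = N - J.card + 2 by omega,
    show N + 1 + 1 - (J.card + 1) = N - J.card + 1 by omega,
    show N + 1 + 1 - (J.card + 1 + 1) = N - J.card by omega, pow_succ, pow_succ]
  linear_combination (-1 : ℝ) ^ (N - J.card) / (N + 2).factorial * hd J.card

/-- Sharpness of Fenchel's inequality for the cross-polytope `Oₙ`:
`V(L₁,K[n−1]) · V(L₂,K[n−1]) = (1/2) · V(L₁,L₂,K[n−2]) · vol(K)`. -/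
theorem cross_polytope_fenchel_sharp (n : ℕ) (hn : 2 ≤ n)
    (K L₁ L₂ : Set (EuclideanSpace ℝ (Fin n)))
    (hK : K = {x : EuclideanSpace ℝ (Fin n) | ∑ i, |x i| ≤ 1})
    (hL₁ : L₁ = segment ℝ 0
      (EuclideanSpace.single (⟨0, by omega⟩ : Fin n) (1 : ℝ) +
        EuclideanSpace.single (⟨1, by omega⟩ : Fin n) (1 : ℝ)))
    (hL₂ : L₂ = segment ℝ 0
      (EuclideanSpace.single (⟨0, by omega⟩ : Fin n) (1 : ℝ) -
        EuclideanSpace.single (⟨1, by omega⟩ : Fin n) (1 : ℝ))) :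
    mixedVol n (fun i => if (i : ℕ) = 0 then L₁ else K) *
        mixedVol n (fun i => if (i : ℕ) = 0 then L₂ else K) =
      (1 / 2) *
        mixedVol n (fun i => if (i : ℕ) = 0 then L₁ else if (i : ℕ) = 1 then L₂ else K) *
        (volume K).toReal := by
  obtain ⟨N, rfl⟩ := Nat.exists_eq_add_of_le' hn
  replace hK : K = euclideanL1Ball (N + 2) 1 := hK
  have hvol (m : ℝ) (hm : 0 ≤ m) : (volume (euclideanL1Ball (N + 2) m)).toReal =
      (2 * m) ^ (N + 2) / (N + 2).factorial := by
    simpa using volume_segment_add_segment_add_euclideanL1Ball N le_rfl le_rfl hm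
  have hvol₁ (m : ℝ) (hm : 0 ≤ m) : (volume (L₁ + euclideanL1Ball (N + 2) m)).toReal =
      (2 * m) ^ (N + 2) / (N + 2).factorial + (2 * m) ^ (N + 1) / (N + 1).factorial := by
    have h := volume_segment_add_segment_add_euclideanL1Ball N zero_le_one le_rfl hm
    rw [zero_smul, segment_same, Set.singleton_zero, zero_add, one_smul] at h
    subst hL₁
    refine h.trans ?_
    ring
  have hvol₂ (m : ℝ) (hm : 0 ≤ m) : (volume (L₂ + euclideanL1Ball (N + 2) m)).toReal =
      (2 * m) ^ (N + 2) / (N + 2).factorial + (2 * m) ^ (N + 1) / (N + 1).factorial := by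
    have h := volume_segment_add_segment_add_euclideanL1Ball N le_rfl zero_le_one hm
    rw [zero_smul, segment_same, Set.singleton_zero, zero_add, one_smul] at h
    subst hL₂
    refine h.trans ?_
    ring
  have hvol₁₂ (m : ℝ) (hm : 0 ≤ m) : (volume (L₁ + (L₂ + euclideanL1Ball (N + 2) m))).toReal =
      (2 * m) ^ (N + 2) / (N + 2).factorial + 2 * ((2 * m) ^ (N + 1) / (N + 1).factorial) +
        2 * ((2 * m) ^ N / N.factorial) := by
    have h := volume_segment_add_segment_add_euclideanL1Ball N zero_le_one zero_le_one hm
    rw [one_smul, one_smul] at h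
    subst hL₁ hL₂
    refine h.trans ?_
    ring
  rw [hK, mixedVol_one_segment (N + 1) L₁ (2 ^ (N + 1) / (N + 1).factorial),
    mixedVol_one_segment (N + 1) L₂ (2 ^ (N + 1) / (N + 1).factorial),
    mixedVol_two_segments N L₁ L₂ (2 * 2 ^ N / N.factorial), hvol 1 zero_le_one]
  · have := (N + 1).factorial_pos
    have := N.factorial_pos
    field_simp
    ring
  · intro m
    rw [hvol₁₂ m m.cast_nonneg, hvol₁ m m.cast_nonneg, hvol₂ m m.cast_nonneg,
      hvol m m.cast_nonneg]
    ring
  · intro m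
    rw [hvol₂ m m.cast_nonneg, hvol m m.cast_nonneg]
    ring
  · intro m
    rw [hvol₁ m m.cast_nonneg, hvol m m.cast_nonneg]
    ring
end

section
/- (Sharpness of b(K) ≤ n at the cube.) Let n ≥ 2, let C = [0,1]ⁿ be the unit cube in ℝⁿ, and let Lᵢ = [0, eᵢ] be the segment from the origin to the i-th standard basis vector, for i = 1, …, n. Then V(L₁, L₂, …, Lₙ)·vol(C) = n·V(L₁, C[n−1])·V(C, L₂, …, Lₙ). -/
open Pointwise MeasureTheory

/-- Polarization of the product of linear forms: Ryser's formula for the permanent. -/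
theorem Matrix.sum_neg_one_pow_mul_prod_sum_eq_permanent {ι R : Type*} [Fintype ι] [DecidableEq ι]
    [CommRing R] (a : Matrix ι ι R) :
    ∑ J : Finset ι, (-1 : R) ^ (Fintype.card ι - J.card) * ∏ i, ∑ j ∈ J, a j i = a.permanent := by
  have key (f : ι → ι) :
      ∑ J : Finset ι, (-1 : R) ^ (Fintype.card ι - J.card) * (if ∀ i, f i ∈ J then 1 else 0) =
        if Function.Bijective f then 1 else 0 := by
    have h := congrArg (Int.cast : ℤ → R)
      (Finset.sum_powerset_neg_one_pow_card (x := (Finset.univ.image f)ᶜ))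
    push_cast at h
    rw [← Equiv.sum_comp (compl_involutive (α := Finset ι)).toPerm]
    have h1 (K : Finset ι) : (∀ i, f i ∈ Kᶜ) ↔ K ∈ ((Finset.univ.image f)ᶜ).powerset := by
      simp only [Finset.mem_powerset, Finset.subset_iff, Finset.mem_compl, Finset.mem_image,
        Finset.mem_univ, true_and]
      grind
    have h2 : (Finset.univ.image f)ᶜ = ∅ ↔ Function.Bijective f := by
      rw [Finset.compl_eq_empty_iff, ← Finite.surjective_iff_bijective, Finset.eq_univ_iff_forall]
      simp [Function.Surjective]
    calc _ = ∑ K : Finset ι, if K ∈ ((Finset.univ.image f)ᶜ).powerset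
            then (-1 : R) ^ K.card else 0 := by
          refine Finset.sum_congr rfl fun K _ => ?_
          simp only [Function.Involutive.coe_toPerm, h1, mul_ite, mul_one, mul_zero]
          rw [Finset.card_compl, Nat.sub_sub_self (Finset.card_le_univ K)]
      _ = _ := by
          rw [Finset.sum_ite_mem, Finset.univ_inter, h]
          simp only [h2]
  have expand (J : Finset ι) : ∏ i, ∑ j ∈ J, a j i =
      ∑ f : ι → ι, (if ∀ i, f i ∈ J then 1 else 0) * ∏ i, a (f i) i := by
    rw [Finset.prod_univ_sum]
    simp only [ite_mul, one_mul, zero_mul]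
    rw [← Finset.sum_filter]
    refine Finset.sum_congr (by ext; simp [Fintype.mem_piFinset]) fun _ _ => rfl
  calc _ = ∑ f : ι → ι, (∑ J : Finset ι, (-1 : R) ^ (Fintype.card ι - J.card) *
          (if ∀ i, f i ∈ J then 1 else 0)) * ∏ i, a (f i) i := by
        simp only [expand, Finset.mul_sum, Finset.sum_mul, mul_assoc]
        rw [Finset.sum_comm]
    _ = ∑ f : ι → ι with Function.Bijective f, ∏ i, a (f i) i := by
        simp only [key, ite_mul, one_mul, zero_mul, Finset.sum_filter]
    _ = a.permanent := by
        rw [Matrix.permanent]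
        symm
        refine Finset.sum_bij (fun σ _ => (σ : ι → ι)) (by simp)
          (fun _ _ _ _ h => DFunLike.coe_injective h) (fun f hf => ?_) (fun _ _ => rfl)
        exact ⟨Equiv.ofBijective f (Finset.mem_filter.1 hf).2, Finset.mem_univ _, rfl⟩

/-- The coordinate box `∏ᵢ [0, aᵢ]`. -/
def coordBox {ι : Type*} (a : ι → ℝ) : Set (EuclideanSpace ℝ ι) :=
  {x | ∀ i, x i ∈ Set.Icc 0 (a i)}

theorem coordBox_zero {ι : Type*} : coordBox (0 : ι → ℝ) = 0 := by
  ext x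
  simp only [coordBox, Pi.zero_apply, Set.Icc_self, Set.mem_singleton_iff, Set.mem_ofPred_eq,
    Set.mem_zero]
  exact ⟨fun h => by ext i; exact h i, fun h => by simp [h]⟩

theorem coordBox_add {ι : Type*} {a b : ι → ℝ} (ha : 0 ≤ a) (hb : 0 ≤ b) :
    coordBox a + coordBox b = coordBox (a + b) := by
  ext x
  constructor
  · rintro ⟨y, hy, z, hz, rfl⟩ i
    exact ⟨add_nonneg (hy i).1 (hz i).1, add_le_add (hy i).2 (hz i).2⟩
  · intro hx
    refine ⟨WithLp.toLp 2 fun i => min (x i) (a i), fun i => ?_,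
      WithLp.toLp 2 fun i => x i - min (x i) (a i), fun i => ?_, by ext i; simp⟩
    · exact ⟨le_min (hx i).1 (ha i), min_le_right _ _⟩
    · have h := (hx i).2
      have hbi : 0 ≤ b i := hb i
      simp only [Pi.add_apply] at h
      rcases min_cases (x i) (a i) with ⟨h', _⟩ | ⟨h', _⟩ <;> constructor <;>
        simp only [h'] <;> linarith

theorem sum_coordBox {ι κ : Type*} (J : Finset κ) {a : κ → ι → ℝ} (ha : ∀ j, 0 ≤ a j) :
    ∑ j ∈ J, coordBox (a j) = coordBox (∑ j ∈ J, a j) := by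
  classical
  induction J using Finset.induction_on with
  | empty => simp [coordBox_zero]
  | insert j J hj ih =>
    rw [Finset.sum_insert hj, Finset.sum_insert hj, ih,
      coordBox_add (ha j) (Finset.sum_nonneg fun k _ => ha k)]

theorem volume_coordBox_toReal {ι : Type*} [Fintype ι] {a : ι → ℝ} (ha : 0 ≤ a) :
    (volume (coordBox a)).toReal = ∏ i, a i := by
  have h : coordBox a = WithLp.ofLp ⁻¹' Set.Icc (0 : ι → ℝ) a := by
    ext x
    simp [coordBox, Pi.le_def, forall_and]
  have hv := (EuclideanSpace.volume_preserving_symm_measurableEquiv_toLp ι).measure_preimage_equiv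
    (Set.Icc 0 a)
  rw [MeasurableEquiv.coe_toLp_symm] at hv
  rw [h, hv, Real.volume_Icc_pi_toReal ha]
  simp

theorem segment_single_eq_coordBox {ι : Type*} [DecidableEq ι] (i : ι) :
    segment ℝ 0 (EuclideanSpace.single i (1 : ℝ)) = coordBox (Pi.single i 1) := by
  ext x
  rw [segment_eq_image]
  constructor
  · rintro ⟨t, ht, rfl⟩ k
    rcases eq_or_ne k i with rfl | hk
    · simpa using ht
    · simp [hk]
  · intro hx
    refine ⟨x i, by simpa using hx i, ?_⟩
    ext k
    rcases eq_or_ne k i with rfl | hk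
    · simp
    · have := hx k
      simp only [Pi.single_eq_of_ne hk, Set.Icc_self, Set.mem_singleton_iff] at this
      simp [hk, this]

theorem mixedVol_coordBox {n : ℕ} (hn : n ≠ 0) {a : Fin n → Fin n → ℝ} (ha : ∀ j, 0 ≤ a j) :
    mixedVol n (fun j => coordBox (a j)) = (Matrix.of a).permanent / n.factorial := by
  have : NeZero n := ⟨hn⟩
  rw [mixedVol, ← Matrix.sum_neg_one_pow_mul_prod_sum_eq_permanent, one_div_mul_eq_div]
  congr 1
  rw [Finset.powerset_univ, Finset.sum_filter]
  refine Finset.sum_congr rfl fun J _ => ?_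
  rw [sum_coordBox J ha, volume_coordBox_toReal (Finset.sum_nonneg fun j _ => ha j)]
  rcases eq_or_ne J ∅ with rfl | hJ
  · simp [hn]
  · simp [hJ]

theorem permanent_row_zero_single (m : ℕ) :
    (Matrix.of fun j : Fin (m + 1) => if (j : ℕ) = 0 then Pi.single 0 1 else 1 :
      Matrix (Fin (m + 1)) (Fin (m + 1)) ℝ).permanent = m.factorial := by
  have h (σ : Equiv.Perm (Fin (m + 1))) :
      ∏ i, (Matrix.of fun j : Fin (m + 1) => if (j : ℕ) = 0 then Pi.single 0 1 else 1 :
        Matrix (Fin (m + 1)) (Fin (m + 1)) ℝ) (σ i) i = if σ 0 = 0 then 1 else 0 := by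
    split_ifs with h0
    · refine Finset.prod_eq_one fun i _ => ?_
      rcases eq_or_ne i 0 with rfl | hi
      · simp [h0]
      · have : σ i ≠ 0 := fun h' => hi (σ.injective (h'.trans h0.symm))
        simp [this]
    · refine Finset.prod_eq_zero (Finset.mem_univ (σ.symm 0)) ?_
      have : σ.symm 0 ≠ 0 := fun h' => h0 (by simpa using (congrArg σ h').symm)
      simp [this]
  rw [Matrix.permanent, Finset.sum_congr rfl fun σ _ => h σ,
    ← Equiv.sum_comp Equiv.Perm.decomposeFin.symm, Fintype.sum_prod_type]
  simp [Fintype.card_perm]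

/-- A matrix whose rows other than `i₀` are those of the identity has permanent equal to
its diagonal entry at `i₀`. -/
theorem permanent_updateRow_one {ι R : Type*} [Fintype ι] [DecidableEq ι] [CommRing R]
    (i₀ : ι) (v : ι → R) : ((1 : Matrix ι ι R).updateRow i₀ v).permanent = v i₀ := by
  rw [Matrix.permanent, Finset.sum_eq_single 1]
  · rw [Finset.prod_eq_single i₀] <;> simp +contextual [Matrix.updateRow_apply]
  · intro σ _ hσ
    obtain ⟨i, hi, hi'⟩ : ∃ i, σ i ≠ i ∧ σ i ≠ i₀ := by
      by_contra! h
      have h0 : σ i₀ = i₀ := by by_contra h'; exact h' (h _ h')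
      refine hσ (Equiv.ext fun i => ?_)
      by_contra h'
      have : i = i₀ := σ.injective ((h i h').trans h0.symm)
      exact h' (this ▸ h0)
    exact Finset.prod_eq_zero (Finset.mem_univ i) (by simp [Matrix.updateRow_apply, hi, hi'])
  · simp

/-- Sharpness of `b(K) ≤ n` at the unit cube:
`V(L₁,…,Lₙ) · vol(C) = n · V(L₁,C[n−1]) · V(C,L₂,…,Lₙ)` for the edges `Lᵢ = [0,eᵢ]`. -/
theorem cube_bezout_sharp (n : ℕ) (hn : 2 ≤ n)
    (C : Set (EuclideanSpace ℝ (Fin n)))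
    (hC : C = {x : EuclideanSpace ℝ (Fin n) | ∀ i, x i ∈ Set.Icc (0 : ℝ) 1})
    (L : Fin n → Set (EuclideanSpace ℝ (Fin n)))
    (hL : ∀ i, L i = segment ℝ 0 (EuclideanSpace.single i (1 : ℝ))) :
    mixedVol n L * (volume C).toReal =
      (n : ℝ) * mixedVol n (fun i => if (i : ℕ) = 0 then L ⟨0, by omega⟩ else C) *
        mixedVol n (fun i => if (i : ℕ) = 0 then C else L i) := by
  obtain ⟨m, rfl⟩ : ∃ m, n = m + 1 := ⟨n - 1, by omega⟩
  have hC1 : C = coordBox 1 := hC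
  obtain rfl : L = fun i => coordBox (Pi.single i 1) :=
    funext fun i => (hL i).trans (segment_single_eq_coordBox i)
  have hs (i : Fin (m + 1)) : (0 : Fin (m + 1) → ℝ) ≤ Pi.single i 1 :=
    Pi.single_nonneg.2 zero_le_one
  have h1 : mixedVol (m + 1) (fun i => coordBox (Pi.single i 1)) = 1 / (m + 1).factorial := by
    rw [mixedVol_coordBox m.succ_ne_zero hs]
    have : (Matrix.of fun i : Fin (m + 1) => (Pi.single i 1 : Fin (m + 1) → ℝ)) = 1 := by
      ext i j
      simp [Matrix.one_apply, Pi.single_apply, eq_comm]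
    rw [this, Matrix.permanent_one]
  have h2 : mixedVol (m + 1) (fun i => if (i : ℕ) = 0 then coordBox (Pi.single 0 1) else C) =
      m.factorial / (m + 1).factorial := by
    rw [← permanent_row_zero_single m, ← mixedVol_coordBox m.succ_ne_zero]
    · congr 1
      funext i
      rw [hC1]
      split_ifs <;> rfl
    · intro j
      split_ifs
      exacts [hs 0, zero_le_one]
  have h3 : mixedVol (m + 1) (fun i => if (i : ℕ) = 0 then C else coordBox (Pi.single i 1)) =
      1 / (m + 1).factorial := by
    have : (Matrix.of fun i : Fin (m + 1) =>
        if (i : ℕ) = 0 then (1 : Fin (m + 1) → ℝ) else Pi.single i 1) =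
        (1 : Matrix _ _ ℝ).updateRow 0 1 := by
      ext i j
      rcases eq_or_ne i 0 with rfl | hi
      · simp
      · simp [hi, Matrix.updateRow_apply, Matrix.one_apply, Pi.single_apply, eq_comm]
    have hp := permanent_updateRow_one (0 : Fin (m + 1)) (1 : Fin (m + 1) → ℝ)
    rw [Pi.one_apply] at hp
    rw [← this] at hp
    refine Eq.trans ?_ (congrArg (· / ((m + 1).factorial : ℝ)) hp)
    refine Eq.trans ?_ (mixedVol_coordBox m.succ_ne_zero ?_)
    · congr 1
      funext i
      rw [hC1]
      split_ifs <;> rfl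
    · intro j
      split_ifs
      exacts [zero_le_one, hs j]
  have hvol : (volume C).toReal = 1 := by
    rw [hC1, volume_coordBox_toReal zero_le_one]
    simp
  simp only [Fin.mk_zero]
  rw [h1, h2, h3, hvol, Nat.factorial_succ]
  have := Nat.factorial_pos m
  push_cast
  field_simp
end

section
/- Let A and B be compact convex sets in ℝ² with nonempty interior, and for i = 1, 2 let |πᵢ(D)| denote the one-dimensional Lebesgue measure of the orthogonal projection of D onto the i-th coordinate axis. Then the planar mixed volume V₂(A,B) = (1/2)·(vol(A+B) − vol(A) − vol(B)) satisfies V₂(A,B) ≤ (1/2)·(|π₁(A)|·|π₂(B)| + |π₂(A)|·|π₁(B)|). -/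
open Pointwise MeasureTheory

open Set

/-- The sum of two compact convex subsets of the line has length the sum of the lengths. -/
theorem volume_add_of_isCompact_convex {P Q : Set ℝ} (hPc : IsCompact P) (hPv : Convex ℝ P)
    (hQc : IsCompact Q) (hQv : Convex ℝ Q) (hP : P.Nonempty) (hQ : Q.Nonempty) :
    volume (P + Q) = volume P + volume Q := by
  have hP' := eq_Icc_of_connected_compact ⟨hP, hPv.isPreconnected⟩ hPc
  have hQ' := eq_Icc_of_connected_compact ⟨hQ, hQv.isPreconnected⟩ hQc
  have h1 : sInf P ≤ sSup P := by rw [← nonempty_Icc, ← hP']; exact hP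
  have h2 : sInf Q ≤ sSup Q := by rw [← nonempty_Icc, ← hQ']; exact hQ
  rw [hP', hQ', Icc_add_Icc h1 h2]
  simp only [Real.volume_Icc]
  rw [← ENNReal.ofReal_add (by linarith) (by linarith)]
  congr 1
  ring

/-- The projection to the first axis of the part of `A` lying at height at least `y`. -/
def projAbove (A : Set (ℝ × ℝ)) (y : ℝ) : Set ℝ := Prod.fst '' (A ∩ {p | y ≤ p.2})

/-- The part of the bounding box of `A` which does not lie strictly above `A`. -/
def fillDown (A : Set (ℝ × ℝ)) : Set (ℝ × ℝ) :=
  {p | p.2 ∈ Prod.snd '' A ∧ p.1 ∈ projAbove A p.2}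

theorem projAbove_subset (A : Set (ℝ × ℝ)) (y : ℝ) : projAbove A y ⊆ Prod.fst '' A :=
  image_mono inter_subset_left

theorem measurable_volume_projAbove (A : Set (ℝ × ℝ)) :
    Measurable fun y => volume (projAbove A y) :=
  Antitone.measurable fun _ _ h => measure_mono <|
    image_mono <| inter_subset_inter_right _ fun _ hp => le_trans h hp

theorem isCompact_projAbove {A : Set (ℝ × ℝ)} (hA : IsCompact A) (y : ℝ) :
    IsCompact (projAbove A y) :=
  (hA.inter_right (isClosed_le continuous_const continuous_snd)).image continuous_fst

theorem convex_projAbove {A : Set (ℝ × ℝ)} (hA : Convex ℝ A) (y : ℝ) :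
    Convex ℝ (projAbove A y) :=
  (hA.inter (convex_halfSpace_ge (LinearMap.snd ℝ ℝ ℝ).isLinear y)).linear_image
    (LinearMap.fst ℝ ℝ ℝ)

theorem projAbove_add_subset {A B : Set (ℝ × ℝ)} {M N : ℝ} (hM : ∀ p ∈ A, p.2 ≤ M)
    (hN : ∀ p ∈ B, p.2 ≤ N) (y : ℝ) :
    projAbove (A + B) y ⊆ projAbove A (y - N) + projAbove B (y - M) := by
  rintro _ ⟨_, ⟨⟨p, hp, q, hq, rfl⟩, hy⟩, rfl⟩
  have h : y ≤ p.2 + q.2 := hy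
  refine ⟨p.1, ⟨p, ⟨hp, ?_⟩, rfl⟩, q.1, ⟨q, ⟨hq, ?_⟩, rfl⟩, rfl⟩
  · have := hN q hq
    simp only [mem_ofPred_eq]
    linarith
  · have := hM p hp
    simp only [mem_ofPred_eq]
    linarith

theorem volume_projAbove_add_le {A B : Set (ℝ × ℝ)} (hAc : IsCompact A) (hAv : Convex ℝ A)
    (hBc : IsCompact B) (hBv : Convex ℝ B) {M N : ℝ} (hM : ∀ p ∈ A, p.2 ≤ M)
    (hN : ∀ p ∈ B, p.2 ≤ N) (y : ℝ) :
    volume (projAbove (A + B) y) ≤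
      volume (projAbove A (y - N)) + volume (projAbove B (y - M)) := by
  refine (measure_mono (projAbove_add_subset hM hN y)).trans ?_
  rcases (projAbove A (y - N)).eq_empty_or_nonempty with h | h
  · simp [h]
  rcases (projAbove B (y - M)).eq_empty_or_nonempty with h' | h'
  · simp [h']
  exact (volume_add_of_isCompact_convex (isCompact_projAbove hAc _) (convex_projAbove hAv _)
    (isCompact_projAbove hBc _) (convex_projAbove hBv _) h h').le

theorem isClosed_fillDown {A : Set (ℝ × ℝ)} (hA : IsCompact A) : IsClosed (fillDown A) := by
  have h : fillDown A = (Prod.snd ⁻¹' (Prod.snd '' A)) ∩ (A + ({0} : Set ℝ) ×ˢ Iic (0 : ℝ)) := by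
    ext ⟨x, y⟩
    refine and_congr_right fun _ => ⟨?_, ?_⟩
    · rintro ⟨⟨x', y'⟩, ⟨hA', hy⟩, rfl⟩
      have hy : y ≤ y' := hy
      exact ⟨(x', y'), hA', (0, y - y'), ⟨rfl, sub_nonpos.2 hy⟩, by simp⟩
    · rintro ⟨⟨x', y'⟩, hA', ⟨u, v⟩, ⟨hu, hv⟩, he⟩
      simp only [mem_singleton_iff, mem_Iic, Prod.mk_add_mk, Prod.mk.injEq] at hu hv he
      refine ⟨(x', y'), ⟨hA', ?_⟩, ?_⟩
      · simp only [mem_ofPred_eq]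
        linarith
      · simp only
        linarith
  rw [h]
  exact ((hA.image continuous_snd).isClosed.preimage continuous_snd).inter
    ((isClosed_singleton.prod isClosed_Iic).add_left_of_isCompact hA)

theorem volume_fillDown {A : Set (ℝ × ℝ)} (hA : IsCompact A) :
    volume (fillDown A) = ∫⁻ y in Prod.snd '' A, volume (projAbove A y) := by
  rw [Measure.volume_eq_prod, Measure.prod_apply_symm (isClosed_fillDown hA).measurableSet,
    ← lintegral_indicator (hA.image continuous_snd).measurableSet]
  congr 1 with y
  by_cases hy : y ∈ Prod.snd '' A
  · rw [indicator_of_mem hy]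
    congr 1 with x
    exact and_iff_right hy
  · rw [indicator_of_notMem hy]
    convert measure_empty (μ := (volume : Measure ℝ))
    exact eq_empty_of_forall_notMem fun x hx => hy hx.1

theorem setLIntegral_volume_projAbove_sub_le {A : Set (ℝ × ℝ)} (hA : IsCompact A) {m M n N : ℝ}
    (hmM : m ≤ M) (hnN : n ≤ N) (hs : Prod.snd '' A = Icc m M) :
    ∫⁻ y in Icc (m + n) (M + N), volume (projAbove A (y - N)) ≤
      volume (fillDown A) + volume (Prod.fst '' A) * volume (Icc n N) := by
  have hpre : Icc (m + n) (M + N) = (fun y => y - N) ⁻¹' Icc (m - (N - n)) M := by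
    ext y
    simp only [mem_Icc, mem_preimage]
    constructor <;> rintro ⟨h1, h2⟩ <;> constructor <;> linarith
  rw [hpre, (measurePreserving_sub_right volume N).setLIntegral_comp_preimage_emb
    (MeasurableEquiv.subRight N).measurableEmbedding (fun y => volume (projAbove A y)),
    volume_fillDown hA, hs, ← Icc_union_Icc_eq_Icc (b := m) (by linarith) hmM, add_comm]
  refine (lintegral_union_le _ _ _).trans (add_le_add ?_ le_rfl)
  calc ∫⁻ y in Icc (m - (N - n)) m, volume (projAbove A y)
      ≤ ∫⁻ _ in Icc (m - (N - n)) m, volume (Prod.fst '' A) :=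
        lintegral_mono fun y => measure_mono (projAbove_subset A y)
    _ = volume (Prod.fst '' A) * volume (Icc n N) := by
        rw [setLIntegral_const, Real.volume_Icc, Real.volume_Icc]
        congr 2
        ring

theorem image_snd_eq_Icc {A : Set (ℝ × ℝ)} (hAc : IsCompact A) (hAv : Convex ℝ A)
    (hA : A.Nonempty) : ∃ m M, m ≤ M ∧ Prod.snd '' A = Icc m M := by
  have h := eq_Icc_of_connected_compact ⟨hA.image Prod.snd,
    (hAv.linear_image (LinearMap.snd ℝ ℝ ℝ)).isPreconnected⟩ (hAc.image continuous_snd)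
  exact ⟨_, _, nonempty_Icc.1 (h ▸ hA.image Prod.snd), h⟩

theorem volume_fillDown_add_le {A B : Set (ℝ × ℝ)} (hAc : IsCompact A) (hAv : Convex ℝ A)
    (hA : A.Nonempty) (hBc : IsCompact B) (hBv : Convex ℝ B) (hB : B.Nonempty) :
    volume (fillDown (A + B)) ≤
      (volume (fillDown A) + volume (Prod.fst '' A) * volume (Prod.snd '' B)) +
      (volume (fillDown B) + volume (Prod.fst '' B) * volume (Prod.snd '' A)) := by
  obtain ⟨m, M, hmM, hsA⟩ := image_snd_eq_Icc hAc hAv hA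
  obtain ⟨n, N, hnN, hsB⟩ := image_snd_eq_Icc hBc hBv hB
  have hM : ∀ p ∈ A, p.2 ≤ M := fun p hp => (hsA ▸ mem_image_of_mem Prod.snd hp).2
  have hN : ∀ p ∈ B, p.2 ≤ N := fun p hp => (hsB ▸ mem_image_of_mem Prod.snd hp).2
  have hs : Prod.snd '' (A + B) = Icc (m + n) (M + N) := by
    rw [← Icc_add_Icc hmM hnN, ← hsA, ← hsB]
    exact image_add (AddMonoidHom.snd ℝ ℝ)
  rw [volume_fillDown (hAc.add hBc), hs]
  calc ∫⁻ y in Icc (m + n) (M + N), volume (projAbove (A + B) y)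
      ≤ ∫⁻ y in Icc (m + n) (M + N),
          (volume (projAbove A (y - N)) + volume (projAbove B (y - M))) :=
        lintegral_mono fun y => volume_projAbove_add_le hAc hAv hBc hBv hM hN y
    _ = (∫⁻ y in Icc (m + n) (M + N), volume (projAbove A (y - N))) +
          ∫⁻ y in Icc (n + m) (N + M), volume (projAbove B (y - M)) := by
        have hmeas : Measurable fun y => volume (projAbove A (y - N)) :=
          (measurable_volume_projAbove A).comp (measurable_id.sub_const N)
        rw [lintegral_add_left hmeas, add_comm n m, add_comm N M]
    _ ≤ _ := by
        rw [hsA, hsB]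
        exact add_le_add (setLIntegral_volume_projAbove_sub_le hAc hmM hnN hsA)
          (setLIntegral_volume_projAbove_sub_le hBc hnN hmM hsB)

theorem mem_neg_fillDown_neg {A : Set (ℝ × ℝ)} {p : ℝ × ℝ} :
    p ∈ -fillDown (-A) ↔ p.2 ∈ Prod.snd '' A ∧ ∃ q ∈ A, q.1 = p.1 ∧ q.2 ≤ p.2 := by
  constructor
  · rintro ⟨⟨r, hr, hr'⟩, ⟨q, ⟨hq, hq'⟩, hq''⟩⟩
    refine ⟨⟨-r, hr, ?_⟩, -q, hq, ?_, ?_⟩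
    · simp_all
    · simp_all
    · simpa using neg_le_neg (show (-p).2 ≤ q.2 from hq')
  · rintro ⟨⟨r, hr, hr'⟩, q, hq, hq', hq''⟩
    exact ⟨⟨-r, by simpa using hr, by simpa using hr'⟩,
      ⟨-q, ⟨by simpa using hq, by simpa using hq''⟩, by simpa using hq'⟩⟩

theorem volume_fillDown_add_volume_fillDown_neg {A : Set (ℝ × ℝ)} (hAc : IsCompact A)
    (hAv : Convex ℝ A) :
    volume (fillDown A) + volume (fillDown (-A)) =
      volume A + volume (Prod.fst '' A) * volume (Prod.snd '' A) := by
  have hU : fillDown A ∪ -fillDown (-A) = (Prod.fst '' A) ×ˢ (Prod.snd '' A) := by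
    ext p
    rw [mem_union, mem_neg_fillDown_neg]
    constructor
    · rintro (⟨h, q, ⟨hq, -⟩, hq'⟩ | ⟨h, q, hq, hq', -⟩)
      · exact ⟨⟨q, hq, hq'⟩, h⟩
      · exact ⟨⟨q, hq, hq'⟩, h⟩
    · rintro ⟨⟨q, hq, hq'⟩, h⟩
      rcases le_total p.2 q.2 with hl | hl
      · exact Or.inl ⟨h, q, ⟨hq, hl⟩, hq'⟩
      · exact Or.inr ⟨h, q, hq, hq', hl⟩
  have hI : fillDown A ∩ -fillDown (-A) = A := by
    ext p
    rw [mem_inter_iff, mem_neg_fillDown_neg]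
    constructor
    · rintro ⟨⟨-, q, ⟨hq, hl⟩, hq'⟩, -, r, hr, hr', hl'⟩
      obtain ⟨x, y⟩ := p
      obtain ⟨x₁, y₁⟩ := q
      obtain ⟨x₂, y₂⟩ := r
      simp only [mem_ofPred_eq] at hl hq' hr' hl'
      subst hq' hr'
      have hy : y ∈ segment ℝ y₂ y₁ := by
        rw [segment_eq_Icc (hl'.trans hl)]
        exact ⟨hl', hl⟩
      refine hAv.segment_subset hr hq ?_
      rw [← Prod.image_mk_segment_right]
      exact ⟨y, hy, rfl⟩
    · intro hp
      exact ⟨⟨⟨p, hp, rfl⟩, p, ⟨hp, le_refl p.2⟩, rfl⟩, ⟨p, hp, rfl⟩, p, hp, rfl, le_rfl⟩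
  have h := measure_union_add_inter (μ := volume) (fillDown A)
    (isClosed_fillDown hAc.neg).neg.measurableSet
  rw [hU, hI, Measure.measure_neg, Measure.volume_eq_prod, Measure.prod_prod] at h
  rw [Measure.volume_eq_prod, ← h, add_comm]

theorem volume_image_fst_neg (A : Set (ℝ × ℝ)) :
    volume (Prod.fst '' (-A)) = volume (Prod.fst '' A) := by
  rw [← Measure.measure_neg volume (Prod.fst '' A)]
  congr 1
  exact image_neg (AddMonoidHom.fst ℝ ℝ) A

theorem volume_image_snd_neg (A : Set (ℝ × ℝ)) :
    volume (Prod.snd '' (-A)) = volume (Prod.snd '' A) := by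
  rw [← Measure.measure_neg volume (Prod.snd '' A)]
  congr 1
  exact image_neg (AddMonoidHom.snd ℝ ℝ) A

theorem volume_add_sub_le_projections_prod {A B : Set (ℝ × ℝ)} (hAc : IsCompact A)
    (hAv : Convex ℝ A) (hA : A.Nonempty) (hBc : IsCompact B) (hBv : Convex ℝ B)
    (hB : B.Nonempty) :
    volume.real (A + B) - volume.real A - volume.real B ≤
      volume.real (Prod.fst '' A) * volume.real (Prod.snd '' B) +
        volume.real (Prod.snd '' A) * volume.real (Prod.fst '' B) := by
  have h1 := volume_fillDown_add_le hAc hAv hA hBc hBv hB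
  have h2 := volume_fillDown_add_le hAc.neg hAv.neg hA.neg hBc.neg hBv.neg hB.neg
  rw [← neg_add] at h2
  simp only [volume_image_fst_neg, volume_image_snd_neg] at h2
  have hfA := (hAc.image continuous_fst).measure_ne_top (μ := volume)
  have hsA := (hAc.image continuous_snd).measure_ne_top (μ := volume)
  have hfB := (hBc.image continuous_fst).measure_ne_top (μ := volume)
  have hsB := (hBc.image continuous_snd).measure_ne_top (μ := volume)
  have eA := volume_fillDown_add_volume_fillDown_neg hAc hAv
  have eB := volume_fillDown_add_volume_fillDown_neg hBc hBv
  have eAB := volume_fillDown_add_volume_fillDown_neg (hAc.add hBc) (hAv.add hBv)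
  have hf : volume (Prod.fst '' (A + B)) = volume (Prod.fst '' A) + volume (Prod.fst '' B) := by
    rw [← volume_add_of_isCompact_convex (hAc.image continuous_fst)
      (hAv.linear_image (LinearMap.fst ℝ ℝ ℝ)) (hBc.image continuous_fst)
      (hBv.linear_image (LinearMap.fst ℝ ℝ ℝ)) (hA.image _) (hB.image _)]
    congr 1
    exact image_add (AddMonoidHom.fst ℝ ℝ)
  have hs : volume (Prod.snd '' (A + B)) = volume (Prod.snd '' A) + volume (Prod.snd '' B) := by
    rw [← volume_add_of_isCompact_convex (hAc.image continuous_snd)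
      (hAv.linear_image (LinearMap.snd ℝ ℝ ℝ)) (hBc.image continuous_snd)
      (hBv.linear_image (LinearMap.snd ℝ ℝ ℝ)) (hA.image _) (hB.image _)]
    congr 1
    exact image_add (AddMonoidHom.snd ℝ ℝ)
  rw [hf, hs] at eAB
  have tA := hAc.measure_ne_top (μ := volume)
  have tB := hBc.measure_ne_top (μ := volume)
  have tAB := (hAc.add hBc).measure_ne_top (μ := volume)
  simp only [Measure.real]
  generalize volume (Prod.fst '' A) = fA at *
  generalize volume (Prod.snd '' A) = sA at *
  generalize volume (Prod.fst '' B) = fB at *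
  generalize volume (Prod.snd '' B) = sB at *
  have key : volume (A + B) + (fA + fB) * (sA + sB) ≤
      (volume A + fA * sA) + (volume B + fB * sB) + 2 * (fA * sB + fB * sA) := by
    rw [← eA, ← eB, ← eAB]
    refine (add_le_add h1 h2).trans (le_of_eq ?_)
    ring
  lift fA to NNReal using hfA
  lift sA to NNReal using hsA
  lift fB to NNReal using hfB
  lift sB to NNReal using hsB
  lift volume A to NNReal using tA with a
  lift volume B to NNReal using tB with b
  lift volume (A + B) to NNReal using tAB with c
  have key' : (c : ℝ) + (fA + fB) * (sA + sB) ≤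
      (a + fA * sA) + (b + fB * sB) + 2 * (fA * sB + fB * sA) := by exact_mod_cast key
  simp only [ENNReal.coe_toReal]
  linarith

/-- The coordinate equivalence between the Euclidean plane and `ℝ × ℝ`. -/
noncomputable def euclideanPlaneEquivProd : EuclideanSpace ℝ (Fin 2) ≃L[ℝ] ℝ × ℝ :=
  (EuclideanSpace.equiv (Fin 2) ℝ).trans (ContinuousLinearEquiv.finTwoArrow ℝ ℝ)

theorem volume_image_euclideanPlaneEquivProd (A : Set (EuclideanSpace ℝ (Fin 2))) :
    volume (euclideanPlaneEquivProd '' A) = volume A := by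
  have h : MeasurePreserving euclideanPlaneEquivProd volume volume :=
    (volume_preserving_finTwoArrow ℝ).comp (PiLp.volume_preserving_ofLp (Fin 2))
  rw [← h.measure_preimage_emb euclideanPlaneEquivProd.toHomeomorph.measurableEmbedding,
    euclideanPlaneEquivProd.injective.preimage_image]

/-- For planar convex bodies `A, B`,
`V₂(A,B) ≤ (1/2)(|π₁(A)||π₂(B)| + |π₂(A)||π₁(B)|)`, where `πᵢ` is the projection onto
the `i`-th coordinate axis. -/
theorem planar_mixed_volume_le_projections
    (A B : Set (EuclideanSpace ℝ (Fin 2)))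
    (hAc : IsCompact A) (hAv : Convex ℝ A) (hAi : (interior A).Nonempty)
    (hBc : IsCompact B) (hBv : Convex ℝ B) (hBi : (interior B).Nonempty) :
    (1 / 2) * ((volume (A + B)).toReal - (volume A).toReal - (volume B).toReal) ≤
      (1 / 2) *
        ((volume ((fun x : EuclideanSpace ℝ (Fin 2) => x 0) '' A)).toReal *
            (volume ((fun x : EuclideanSpace ℝ (Fin 2) => x 1) '' B)).toReal +
          (volume ((fun x : EuclideanSpace ℝ (Fin 2) => x 1) '' A)).toReal *
            (volume ((fun x : EuclideanSpace ℝ (Fin 2) => x 0) '' B)).toReal) := by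
  have h := volume_add_sub_le_projections_prod
    (hAc.image euclideanPlaneEquivProd.continuous)
    (hAv.linear_image euclideanPlaneEquivProd.toLinearEquiv.toLinearMap)
    ((hAi.mono interior_subset).image _)
    (hBc.image euclideanPlaneEquivProd.continuous)
    (hBv.linear_image euclideanPlaneEquivProd.toLinearEquiv.toLinearMap)
    ((hBi.mono interior_subset).image _)
  have hadd : euclideanPlaneEquivProd '' A + euclideanPlaneEquivProd '' B =
      euclideanPlaneEquivProd '' (A + B) := (image_add euclideanPlaneEquivProd).symm
  simp only [Measure.real] at h
  change (volume (euclideanPlaneEquivProd '' A + euclideanPlaneEquivProd '' B)).toReal -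
    (volume (euclideanPlaneEquivProd '' A)).toReal -
    (volume (euclideanPlaneEquivProd '' B)).toReal ≤ _ at h
  rw [hadd] at h
  simp only [volume_image_euclideanPlaneEquivProd] at h
  rw [image_image, image_image, image_image, image_image] at h
  exact mul_le_mul_of_nonneg_left h (by norm_num)
end
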